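/- Let H be a Hopf algebra with invertible antipode acting on a unital H-module algebra A. Define Ψ from equivariant n-cochains Hom_H(H ⊗ A^{⊗(n+1)}, ℂ) to n-cochains on A ⋊ H by Ψ(φ)(a⁰⊗h⁰, …, aⁿ⊗hⁿ) = φ(h⁰₍ₙ₊₁₎ ⋯ h^{n-1}₍₂₎ hⁿ, a⁰, h⁰₍₁₎(a¹), …, h⁰₍ₙ₎⋯h^{n-1}₍₁₎(aⁿ)). Then Ψ commutes with the cyclic operators: Ψ(tφ) = τ(Ψφ), where tφ(h, a⁰,…,aⁿ) = φ(h₍₂₎, S⁻¹(h₍₁₎)(aⁿ), a⁰, …, a^{n-1}) and τψ(x⁰,…,xⁿ) = ψ(xⁿ, x⁰, …, x^{n-1}) for x^i ∈ A ⋊ H. -/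

import Mathlib

noncomputable section

open TensorProduct

variable {H A : Type} [Ring H] [HopfAlgebra ℂ H] [Ring A] [Algebra ℂ A]

/-- `sweedler N Δ₁ Δ₂ k g F` is the Sweedler sum `Σ F (g₍₁₎, …, g₍ₖ₊₁₎)`, computed
from a chosen finite representation `comul g = Σ_{i < N g} Δ₁ g i ⊗ Δ₂ g i` of the
comultiplication. -/
def sweedler (N : H → ℕ) (Δ₁ Δ₂ : H → ℕ → H) :
    (k : ℕ) → H → ((Fin (k+1) → H) → ℂ) → ℂ
  | 0, g, F => F ![g]
  | k+1, g, F => ∑ i ∈ Finset.range (N g),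
      sweedler N Δ₁ Δ₂ k (Δ₂ g i) (fun v => F (Fin.cons (Δ₁ g i) v))

/-- The multiplication of the crossed product `A ⋊ H`, as a linear map on
`(A ⊗ H) ⊗ (A ⊗ H)`; on pure tensors it is `(a ⊗ h)(b ⊗ g) = a h₍₁₎(b) ⊗ h₍₂₎ g`. -/
def cpMul (ρ : H →ₗ[ℂ] A →ₗ[ℂ] A) :
    (A ⊗[ℂ] H) ⊗[ℂ] (A ⊗[ℂ] H) →ₗ[ℂ] A ⊗[ℂ] H :=
  (LinearMap.rTensor H (LinearMap.mul' ℂ A)) ∘ₗ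
  (TensorProduct.assoc ℂ A A H).symm.toLinearMap ∘ₗ
  (LinearMap.lTensor A (TensorProduct.map (TensorProduct.lift ρ) (LinearMap.mul' ℂ H))) ∘ₗ
  (LinearMap.lTensor A (TensorProduct.tensorTensorTensorComm ℂ H H A H).toLinearMap) ∘ₗ
  (LinearMap.lTensor A (LinearMap.rTensor (A ⊗[ℂ] H) (Coalgebra.comul (R := ℂ)))) ∘ₗ
  (TensorProduct.assoc ℂ A H (A ⊗[ℂ] H)).toLinearMap

/-- The tuple obtained from `x` by replacing the pair `(xʲ, xʲ⁺¹)` by the single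
entry `y` (used with `y = xʲ xʲ⁺¹` for the `j`-th face map). -/
def faceTup {α : Type} {n : ℕ} (j : Fin (n+1)) (y : α) (x : Fin (n+2) → α) :
    Fin (n+1) → α :=
  fun k => if (k : ℕ) < (j : ℕ) then x k.castSucc else if k = j then y else x k.succ

/-- The `i`-th term of the product `(p.1 ⊗ p.2)(q.1 ⊗ q.2)` in `A ⋊ H`, for the chosen
representation of the comultiplication: `p.1 · (Δ₁ p.2 i)(q.1) ⊗ (Δ₂ p.2 i) q.2`. -/
def cpPairTerm (Δ₁ Δ₂ : H → ℕ → H) (ρ : H →ₗ[ℂ] A →ₗ[ℂ] A) (p q : A × H) (i : ℕ) :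
    A × H :=
  (p.1 * ρ (Δ₁ p.2 i) q.1, Δ₂ p.2 i * q.2)

/-- The Hochschild coboundary of a cochain on the crossed product `A ⋊ H`. -/
def cpb (ρ : H →ₗ[ℂ] A →ₗ[ℂ] A) {n : ℕ} (f : (Fin (n+1) → A ⊗[ℂ] H) → ℂ) :
    (Fin (n+2) → A ⊗[ℂ] H) → ℂ := fun x =>
  (∑ j : Fin (n+1), (-1 : ℂ) ^ (j : ℕ) *
      f (faceTup j (cpMul ρ (x j.castSucc ⊗ₜ[ℂ] x j.succ)) x))
  + (-1 : ℂ) ^ (n+1) *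
      f (fun k => if (k : ℕ) = 0 then cpMul ρ (x (Fin.last (n+1)) ⊗ₜ[ℂ] x 0)
                  else x k.castSucc)

/-- `f` vanishes whenever some argument in position `≥ 1` lies in the subalgebra
`1 ⊗ H` of `A ⋊ H`. -/
def HConstVanish {m : ℕ} (f : (Fin m → A ⊗[ℂ] H) → ℂ) : Prop :=
  ∀ x : Fin m → A ⊗[ℂ] H,
    (∃ j : Fin m, 0 < (j : ℕ) ∧ ∃ h : H, x j = (1 : A) ⊗ₜ[ℂ] h) → f x = 0

/-- An `H`-constant cochain on `A ⋊ H`: both `f` and `bf` vanish whenever some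
argument in position `≥ 1` lies in `1 ⊗ H`. -/
def IsHConstant (ρ : H →ₗ[ℂ] A →ₗ[ℂ] A) {n : ℕ}
    (f : MultilinearMap ℂ (fun _ : Fin (n+1) => A ⊗[ℂ] H) ℂ) : Prop :=
  HConstVanish ⇑f ∧ HConstVanish (cpb ρ ⇑f)

/-- Auxiliary recursion for `Ψ`: processes the pairs `x¹, …, xᵏ`, keeping an
accumulated Hopf algebra element `g`; at each step `Δg = g₍₁₎ ⊗ g₍₂₎` is split, the
current slot becomes `g₍₁₎(aʲ)` and the accumulator becomes `g₍₂₎ hʲ`. -/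
def psiAux (N : H → ℕ) (Δ₁ Δ₂ : H → ℕ → H) (ρ : H →ₗ[ℂ] A →ₗ[ℂ] A) :
    (k : ℕ) → H → (Fin k → A × H) → (H → (Fin k → A) → ℂ) → ℂ
  | 0, g, _, F => F g ![]
  | k+1, g, x, F => ∑ i ∈ Finset.range (N g),
      psiAux N Δ₁ Δ₂ ρ k (Δ₂ g i * (x 0).2) (fun j => x j.succ)
        (fun h v => F h (Fin.cons (ρ (Δ₁ g i) (x 0).1) v))

/-- The value of `Ψφ` on the elementary tensors `a⁰ ⊗ h⁰, …, aⁿ ⊗ hⁿ`: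
`Ψ(φ)(a⁰⊗h⁰, …, aⁿ⊗hⁿ) = φ(h⁰₍ₙ₊₁₎ ⋯ h^{n-1}₍₂₎ hⁿ, a⁰, h⁰₍₁₎(a¹), …,
h⁰₍ₙ₎⋯h^{n-1}₍₁₎(aⁿ))`. -/
def psiV (N : H → ℕ) (Δ₁ Δ₂ : H → ℕ → H) (ρ : H →ₗ[ℂ] A →ₗ[ℂ] A) {n : ℕ}
    (φf : H → (Fin (n+1) → A) → ℂ) (x : Fin (n+1) → A × H) : ℂ :=
  psiAux N Δ₁ Δ₂ ρ n ((x 0).2) (fun j => x j.succ)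
    (fun h v => φf h (Fin.cons (x 0).1 v))

/-- The equivariance condition `φ(S(g₍₂₎) h g₍₁₎, a⁰, …, aⁿ) =
φ(h, g₍₁₎(a⁰), …, g₍ₙ₊₁₎(aⁿ))` for a cochain `φ : H ⊗ A^{⊗(n+1)} → ℂ`. -/
def IsEquivariant (N : H → ℕ) (Δ₁ Δ₂ : H → ℕ → H) (ρ : H →ₗ[ℂ] A →ₗ[ℂ] A) {n : ℕ}
    (φf : H → (Fin (n+1) → A) → ℂ) : Prop :=
  ∀ (g h : H) (a : Fin (n+1) → A),
    sweedler N Δ₁ Δ₂ 1 g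
      (fun ℓ => φf (HopfAlgebra.antipode (R := ℂ) (ℓ 1) * h * ℓ 0) a)
      = sweedler N Δ₁ Δ₂ n g (fun ℓ => φf h (fun j => ρ (ℓ j) (a j)))

/-- The cyclic operator on equivariant cochains:
`t φ(h, a⁰, …, aⁿ) = φ(h₍₂₎, S⁻¹(h₍₁₎)(aⁿ), a⁰, …, aⁿ⁻¹)`. -/
def cycOpEq (N : H → ℕ) (Δ₁ Δ₂ : H → ℕ → H) (ρ : H →ₗ[ℂ] A →ₗ[ℂ] A)
    (Sinv : H →ₗ[ℂ] H) {n : ℕ} (φf : H → (Fin (n+1) → A) → ℂ) :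
    H → (Fin (n+1) → A) → ℂ := fun h a =>
  sweedler N Δ₁ Δ₂ 1 h (fun ℓ =>
    φf (ℓ 1) (Fin.cons (ρ (Sinv (ℓ 0)) (a (Fin.last n))) (fun j : Fin n => a j.castSucc)))

/-- The map `Φ`: `(Φf)(h, a⁰, …, aⁿ) = f(a⁰ ⊗ 1, …, aⁿ⁻¹ ⊗ 1, aⁿ ⊗ h)`. -/
def phiV {n : ℕ} (f : MultilinearMap ℂ (fun _ : Fin (n+1) => A ⊗[ℂ] H) ℂ) :
    H → (Fin (n+1) → A) → ℂ := fun h a =>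
  f (fun i => if i = Fin.last n then a i ⊗ₜ[ℂ] h else a i ⊗ₜ[ℂ] (1 : H))


/-- Sweedler sum of length two. -/
def EE (N : H → ℕ) (Δ₁ Δ₂ : H → ℕ → H) (g : H) (B : H → H → ℂ) : ℂ :=
  ∑ i ∈ Finset.range (N g), B (Δ₁ g i) (Δ₂ g i)

/-- the chosen representation is one of the comultiplication -/
def HRep (N : H → ℕ) (Δ₁ Δ₂ : H → ℕ → H) : Prop :=
  ∀ g : H, (Coalgebra.comul (R := ℂ) g : H ⊗[ℂ] H) =
      ∑ i ∈ Finset.range (N g), Δ₁ g i ⊗ₜ[ℂ] Δ₂ g i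

theorem EE_eq {N : H → ℕ} {Δ₁ Δ₂ : H → ℕ → H} (hrep : HRep N Δ₁ Δ₂)
    (B : H →ₗ[ℂ] H →ₗ[ℂ] ℂ) (g : H) :
    EE N Δ₁ Δ₂ g (fun u w => B u w) = TensorProduct.lift B (Coalgebra.comul (R := ℂ) g) := by
  rw [hrep g, map_sum]; simp [EE]

set_option linter.unusedSectionVars false

theorem EE_comm {N : H → ℕ} {Δ₁ Δ₂ : H → ℕ → H} (g h : H) (B : H → H → H → H → ℂ) :
    EE N Δ₁ Δ₂ g (fun u w => EE N Δ₁ Δ₂ h (fun p q => B u w p q))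
     = EE N Δ₁ Δ₂ h (fun p q => EE N Δ₁ Δ₂ g (fun u w => B u w p q)) := by
  unfold EE; exact Finset.sum_comm

theorem EE_mul {N : H → ℕ} {Δ₁ Δ₂ : H → ℕ → H} (hrep : HRep N Δ₁ Δ₂)
    (B : H →ₗ[ℂ] H →ₗ[ℂ] ℂ) (g h : H) :
    EE N Δ₁ Δ₂ (g * h) (fun u w => B u w) =
     EE N Δ₁ Δ₂ g (fun u w => EE N Δ₁ Δ₂ h (fun p q => B (u * p) (w * q))) := by
  rw [EE_eq hrep, Bialgebra.comul_mul, hrep g, hrep h, Finset.sum_mul_sum]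
  simp [EE, map_sum]

theorem EE_one {N : H → ℕ} {Δ₁ Δ₂ : H → ℕ → H} (hrep : HRep N Δ₁ Δ₂)
    (B : H →ₗ[ℂ] H →ₗ[ℂ] ℂ) :
    EE N Δ₁ Δ₂ 1 (fun u w => B u w) = B 1 1 := by
  rw [EE_eq hrep, Bialgebra.comul_one]; simp [Algebra.TensorProduct.one_def]

theorem EE_coassoc {N : H → ℕ} {Δ₁ Δ₂ : H → ℕ → H} (hrep : HRep N Δ₁ Δ₂)
    (T : H →ₗ[ℂ] H →ₗ[ℂ] H →ₗ[ℂ] ℂ) (g : H) :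
    EE N Δ₁ Δ₂ g (fun u w => EE N Δ₁ Δ₂ w (fun p q => T u p q)) =
    EE N Δ₁ Δ₂ g (fun u w => EE N Δ₁ Δ₂ u (fun p q => T p q w)) := by
  have h := congrArg (TensorProduct.lift (TensorProduct.uncurry (RingHom.id ℂ) H H ℂ ∘ₗ T))
    (Coalgebra.coassoc_apply (R := ℂ) g)
  rw [hrep g] at h
  simp only [map_sum, LinearMap.rTensor_tmul, LinearMap.lTensor_tmul, TensorProduct.lift.tmul,
    LinearMap.comp_apply, TensorProduct.uncurry_apply] at h
  simp only [hrep (Δ₁ g _), hrep (Δ₂ g _), map_sum, TensorProduct.sum_tmul,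
    TensorProduct.assoc_tmul, TensorProduct.lift.tmul, LinearMap.comp_apply,
    TensorProduct.uncurry_apply] at h
  exact h.symm

theorem EE_counit_left {N : H → ℕ} {Δ₁ Δ₂ : H → ℕ → H} (hrep : HRep N Δ₁ Δ₂)
    (L : H →ₗ[ℂ] ℂ) (g : H) :
    EE N Δ₁ Δ₂ g (fun u w => Coalgebra.counit (R := ℂ) u * L w) = L g := by
  have h := congrArg (TensorProduct.lift ((LinearMap.lsmul ℂ ℂ).compl₂ L))
    (Coalgebra.rTensor_counit_comul (R := ℂ) g)
  rw [hrep g] at h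
  simpa [EE, map_sum] using h

theorem EE_counit_right {N : H → ℕ} {Δ₁ Δ₂ : H → ℕ → H} (hrep : HRep N Δ₁ Δ₂)
    (L : H →ₗ[ℂ] ℂ) (g : H) :
    EE N Δ₁ Δ₂ g (fun u w => Coalgebra.counit (R := ℂ) w * L u) = L g := by
  have h := congrArg (TensorProduct.lift ((LinearMap.lsmul ℂ ℂ).compl₂ L).flip)
    (Coalgebra.lTensor_counit_comul (R := ℂ) g)
  rw [hrep g] at h
  simpa [EE, map_sum] using h

theorem rep_S_mul {N : H → ℕ} {Δ₁ Δ₂ : H → ℕ → H} (hrep : HRep N Δ₁ Δ₂) (g : H) :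
    ∑ i ∈ Finset.range (N g), HopfAlgebra.antipode (R := ℂ) (Δ₁ g i) * Δ₂ g i
      = Coalgebra.counit (R := ℂ) g • (1 : H) := by
  have h := HopfAlgebra.mul_antipode_rTensor_comul_apply (R := ℂ) g
  rw [hrep g] at h
  simpa [map_sum, Algebra.algebraMap_eq_smul_one] using h

theorem rep_mul_S {N : H → ℕ} {Δ₁ Δ₂ : H → ℕ → H} (hrep : HRep N Δ₁ Δ₂) (g : H) :
    ∑ i ∈ Finset.range (N g), Δ₁ g i * HopfAlgebra.antipode (R := ℂ) (Δ₂ g i)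
      = Coalgebra.counit (R := ℂ) g • (1 : H) := by
  have h := HopfAlgebra.mul_antipode_lTensor_comul_apply (R := ℂ) g
  rw [hrep g] at h
  simpa [map_sum, Algebra.algebraMap_eq_smul_one] using h

/-- two-sided inverse of the antipode -/
def SI (Sinv : H →ₗ[ℂ] H) : Prop := ∀ h : H, Sinv (HopfAlgebra.antipode (R := ℂ) h) = h ∧
      HopfAlgebra.antipode (R := ℂ) (Sinv h) = h

theorem Sinv_mul {Sinv : H →ₗ[ℂ] H} (hS : SI Sinv) (a b : H) :
    Sinv (a * b) = Sinv b * Sinv a := by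
  have : HopfAlgebra.antipode (R := ℂ) (Sinv b * Sinv a) = a * b := by
    rw [HopfAlgebra.antipode_mul_antidistrib, (hS a).2, (hS b).2]
  rw [← this, (hS _).1]

theorem Sinv_one {Sinv : H →ₗ[ℂ] H} (hS : SI Sinv) : Sinv 1 = 1 := by
  conv_lhs => rw [← HopfAlgebra.antipode_one (R := ℂ) (A := H)]
  exact (hS 1).1

theorem rep_Sinv_mul {N : H → ℕ} {Δ₁ Δ₂ : H → ℕ → H} (hrep : HRep N Δ₁ Δ₂)
    {Sinv : H →ₗ[ℂ] H} (hS : SI Sinv) (g : H) :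
    ∑ i ∈ Finset.range (N g), Sinv (Δ₂ g i) * Δ₁ g i
      = Coalgebra.counit (R := ℂ) g • (1 : H) := by
  have h := congrArg Sinv (rep_S_mul hrep g)
  simpa [map_sum, Sinv_mul hS, Sinv_one hS, (hS _).1] using h

theorem rep_mul_Sinv {N : H → ℕ} {Δ₁ Δ₂ : H → ℕ → H} (hrep : HRep N Δ₁ Δ₂)
    {Sinv : H →ₗ[ℂ] H} (hS : SI Sinv) (g : H) :
    ∑ i ∈ Finset.range (N g), Δ₂ g i * Sinv (Δ₁ g i)
      = Coalgebra.counit (R := ℂ) g • (1 : H) := by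
  have h := congrArg Sinv (rep_mul_S hrep g)
  simpa [map_sum, Sinv_mul hS, Sinv_one hS, (hS _).1] using h

theorem K1 {N : H → ℕ} {Δ₁ Δ₂ : H → ℕ → H} (hrep : HRep N Δ₁ Δ₂)
    {Sinv : H →ₗ[ℂ] H} (hS : SI Sinv) (B : H →ₗ[ℂ] H →ₗ[ℂ] ℂ) (g : H) :
    EE N Δ₁ Δ₂ g (fun u w => EE N Δ₁ Δ₂ w (fun p q => B (Sinv p * u) q)) = B 1 g := by
  refine (EE_coassoc hrep (LinearMap.mk₂ ℂ (fun u p => B (Sinv p * u))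
    (by intros; simp [mul_add]) (by intros; simp) (by intros; simp [add_mul])
    (by intros; simp)) g).trans ?_
  refine Eq.trans ?_ (EE_counit_left hrep (B 1) g)
  congr 1; funext u w
  have := congrArg (fun z => B z w) (rep_Sinv_mul hrep hS u)
  simpa [EE, map_sum] using this

theorem K2 {N : H → ℕ} {Δ₁ Δ₂ : H → ℕ → H} (hrep : HRep N Δ₁ Δ₂)
    {Sinv : H →ₗ[ℂ] H} (hS : SI Sinv) (B : H →ₗ[ℂ] H →ₗ[ℂ] ℂ) (g : H) :
    EE N Δ₁ Δ₂ g (fun u w => EE N Δ₁ Δ₂ w (fun p q => B (p * Sinv u) q)) = B 1 g := by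
  refine (EE_coassoc hrep (LinearMap.mk₂ ℂ (fun u p => B (p * Sinv u))
    (by intros; simp [mul_add]) (by intros; simp) (by intros; simp [add_mul])
    (by intros; simp)) g).trans ?_
  refine Eq.trans ?_ (EE_counit_left hrep (B 1) g)
  congr 1; funext u w
  have := congrArg (fun z => B z w) (rep_mul_Sinv hrep hS u)
  simpa [EE, map_sum] using this

theorem K3 {N : H → ℕ} {Δ₁ Δ₂ : H → ℕ → H} (hrep : HRep N Δ₁ Δ₂)
    (B : H →ₗ[ℂ] H →ₗ[ℂ] ℂ) (g : H) :
    EE N Δ₁ Δ₂ g (fun u w => EE N Δ₁ Δ₂ u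
      (fun p q => B p (HopfAlgebra.antipode (R := ℂ) q * w))) = B g 1 := by
  have h := EE_coassoc hrep (
    (LinearMap.mk₂ ℂ (fun p q => B p ∘ₗ LinearMap.mulLeft ℂ (HopfAlgebra.antipode (R := ℂ) q))
    (by intros; ext; simp) (by intros; ext; simp) (by intros; ext; simp [add_mul])
    (by intros; ext; simp))) g
  simp only [LinearMap.mk₂_apply, LinearMap.comp_apply, LinearMap.mulLeft_apply] at h
  rw [← h]
  refine Eq.trans ?_ (EE_counit_right hrep (B.flip 1) g)
  congr 1; funext u w
  have := congrArg (fun z => B u z) (rep_S_mul hrep w)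
  simpa [EE, map_sum] using this

theorem psiAux_rep (N : H → ℕ) (Δ₁ Δ₂ : H → ℕ → H) (ρ : H →ₗ[ℂ] A →ₗ[ℂ] A) (m : ℕ) :
    ∀ (g : H) (x : Fin m → A × H), ∃ (ι : Type) (_ : Fintype ι) (G : ι → H)
      (b : ι → Fin m → A), ∀ F, psiAux N Δ₁ Δ₂ ρ m g x F = ∑ t, F (G t) (b t) := by
  induction m with
  | zero =>
    intro g x
    exact ⟨Unit, inferInstance, fun _ => g, fun _ => ![], fun F => by simp [psiAux]⟩
  | succ m ih =>
    intro g x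
    choose ι hι G b h using fun i : Fin (N g) =>
      ih (Δ₂ g i * (x 0).2) (fun j => x j.succ)
    refine ⟨Σ i, ι i, inferInstance, fun t => G t.1 t.2,
      fun t => Fin.cons (ρ (Δ₁ g t.1) (x 0).1) (b t.1 t.2), fun F => ?_⟩
    rw [Fintype.sum_sigma]
    simp only [psiAux]
    rw [Finset.sum_range]
    exact Finset.sum_congr rfl fun i _ => h i _

theorem sweedler_rep (N : H → ℕ) (Δ₁ Δ₂ : H → ℕ → H) (m : ℕ) :
    ∀ (g : H), ∃ (ι : Type) (_ : Fintype ι)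
      (b : ι → Fin (m+1) → H), ∀ F, sweedler N Δ₁ Δ₂ m g F = ∑ t, F (b t) := by
  induction m with
  | zero =>
    intro g
    exact ⟨Unit, inferInstance, fun _ => ![g], fun F => by simp [sweedler]⟩
  | succ m ih =>
    intro g
    choose ι hι b h using fun i : Fin (N g) => ih (Δ₂ g i)
    refine ⟨Σ i, ι i, inferInstance,
      fun t => Fin.cons (Δ₁ g t.1) (b t.1 t.2), fun F => ?_⟩
    rw [Fintype.sum_sigma]
    simp only [sweedler]
    rw [Finset.sum_range]
    exact Finset.sum_congr rfl fun i _ => h i _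

theorem sweedler_sum {N : H → ℕ} {Δ₁ Δ₂ : H → ℕ → H} {m : ℕ} (g : H) {ι : Type}
    (s : Finset ι) (F : ι → (Fin (m+1) → H) → ℂ) :
    sweedler N Δ₁ Δ₂ m g (fun v => ∑ i ∈ s, F i v) = ∑ i ∈ s, sweedler N Δ₁ Δ₂ m g (F i) := by
  obtain ⟨κ, _, b, h⟩ := sweedler_rep N Δ₁ Δ₂ m g
  simp only [h]
  exact Finset.sum_comm

/-- the cochains -/
abbrev Coch (H A : Type) [Ring H] [HopfAlgebra ℂ H] [Ring A] [Algebra ℂ A] (m : ℕ) : Type :=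
  H →ₗ[ℂ] MultilinearMap ℂ (fun _ : Fin m => A) ℂ

/-- fill the zeroth slot -/
def slot {m : ℕ} (f : Coch H A (m+1)) : A →ₗ[ℂ] Coch H A m :=
  LinearMap.mk₂ ℂ (fun a h => (f h).curryLeft a)
    (by intros; simp) (by intros; simp)
    (by intros; ext; simp) (by intros; ext; simp)

theorem slot_apply {m : ℕ} (f : Coch H A (m+1)) (a : A) (h : H) (v : Fin m → A) :
    slot f a h v = f h (Fin.cons a v) := rfl

theorem psi_lin {N : H → ℕ} {Δ₁ Δ₂ : H → ℕ → H} (hrep : HRep N Δ₁ Δ₂)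
    (ρ : H →ₗ[ℂ] A →ₗ[ℂ] A) (m : ℕ) :
    ∀ (x : Fin m → A × H) (f : Coch H A m), ∃ L : H →ₗ[ℂ] ℂ,
      ∀ g, psiAux N Δ₁ Δ₂ ρ m g x (fun h v => f h v) = L g := by
  induction m with
  | zero =>
    intro x f
    exact ⟨IsLinearMap.mk' (fun g => f g ![]) ⟨(by intros; simp), (by intros; simp)⟩,
      fun g => rfl⟩
  | succ m ih =>
    intro x f
    choose L hL using fun a => ih (fun j => x j.succ) (slot f a)
    have hadd : ∀ a a' g, L (a + a') g = L a g + L a' g := by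
      intro a a' g
      obtain ⟨ι, _, G, b, h⟩ := psiAux_rep N Δ₁ Δ₂ ρ m g (fun j => x j.succ)
      simp [← hL, h, Finset.sum_add_distrib]
    have hsmul : ∀ (c : ℂ) a g, L (c • a) g = c • L a g := by
      intro c a g
      obtain ⟨ι, _, G, b, h⟩ := psiAux_rep N Δ₁ Δ₂ ρ m g (fun j => x j.succ)
      simp [← hL, h, Finset.mul_sum]
    refine ⟨TensorProduct.lift (LinearMap.mk₂ ℂ (fun u w => L (ρ u (x 0).1) (w * (x 0).2))
      (by intros; simp [hadd]) (by intros; simp only [map_smul, LinearMap.smul_apply, hsmul])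
      (by intros; simp [add_mul])
      (by intros; simp)) ∘ₗ Coalgebra.comul (R := ℂ), fun g => ?_⟩
    rw [LinearMap.comp_apply, ← EE_eq hrep]
    simp only [psiAux, EE, LinearMap.mk₂_apply, ← hL, slot_apply]

theorem psi_bil {N : H → ℕ} {Δ₁ Δ₂ : H → ℕ → H} (hrep : HRep N Δ₁ Δ₂)
    (ρ : H →ₗ[ℂ] A →ₗ[ℂ] A) {m : ℕ} (x : Fin m → A × H) (f : H →ₗ[ℂ] Coch H A m) (c : H) :
    ∃ B : H →ₗ[ℂ] H →ₗ[ℂ] ℂ,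
      ∀ u g, psiAux N Δ₁ Δ₂ ρ m (g * c) x (fun h v => f u h v) = B u g := by
  choose L hL using fun u => psi_lin hrep ρ m x (f u)
  have hadd : ∀ a a' g, L (a + a') g = L a g + L a' g := by
    intro a a' g
    obtain ⟨ι, _, G, b, h⟩ := psiAux_rep N Δ₁ Δ₂ ρ m g x
    simp [← hL, h, Finset.sum_add_distrib]
  have hsmul : ∀ (c : ℂ) a g, L (c • a) g = c • L a g := by
    intro c a g
    obtain ⟨ι, _, G, b, h⟩ := psiAux_rep N Δ₁ Δ₂ ρ m g x
    simp [← hL, h, Finset.mul_sum]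
  exact ⟨LinearMap.mk₂ ℂ (fun u w => L u (w * c))
      (by intros; simp [hadd]) (by intros; simp only [hsmul])
      (by intros; simp [add_mul])
      (by intros; simp), fun u g => hL _ _⟩

theorem psi_R {N : H → ℕ} {Δ₁ Δ₂ : H → ℕ → H} (hrep : HRep N Δ₁ Δ₂)
    (ρ : H →ₗ[ℂ] A →ₗ[ℂ] A) (hρ_mul : ∀ g h : H, ρ (g * h) = ρ g ∘ₗ ρ h) (m : ℕ) :
    ∀ (x : Fin m → A × H) (f : Coch H A m) (k g : H),
      psiAux N Δ₁ Δ₂ ρ m (k * g) x (fun h v => f h v) =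
      sweedler N Δ₁ Δ₂ m k (fun ℓ => psiAux N Δ₁ Δ₂ ρ m g x
        (fun h v => f (ℓ (Fin.last m) * h) (fun j => ρ (ℓ j.castSucc) (v j)))) := by
  induction m with
  | zero =>
    intro x f k g
    simp only [psiAux, sweedler]
    congr 1
    exact Subsingleton.elim _ _
  | succ m ih =>
    intro x f k g
    obtain ⟨B, hB⟩ := psi_bil hrep ρ (fun j => x j.succ) (slot f ∘ₗ ρ.flip (x 0).1) (x 0).2
    have h1 := EE_mul hrep B k g
    simp only [← hB] at h1
    refine Eq.trans h1 ?_
    simp only [psiAux, sweedler, EE]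
    refine Finset.sum_congr rfl fun i _ => ?_
    rw [sweedler_sum]
    refine Finset.sum_congr rfl fun j _ => ?_
    rw [mul_assoc, ih]
    congr 1
    funext ℓ
    congr 1
    funext h v
    simp only [LinearMap.comp_apply, slot_apply, LinearMap.flip_apply, hρ_mul]
    congr 1
    funext t
    refine Fin.cases ?_ (fun t => ?_) t
    · simp
    · simp

theorem sw_eq_psi {N : H → ℕ} {Δ₁ Δ₂ : H → ℕ → H}
    (ρ : H →ₗ[ℂ] A →ₗ[ℂ] A) (m : ℕ) :
    ∀ (b : Fin m → A) (F : H → (Fin m → A) → ℂ) (k : H),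
      sweedler N Δ₁ Δ₂ m k (fun ℓ => F (ℓ (Fin.last m)) (fun j => ρ (ℓ j.castSucc) (b j)))
       = psiAux N Δ₁ Δ₂ ρ m k (fun j => (b j, 1)) F := by
  induction m with
  | zero =>
    intro b F k
    simp only [psiAux, sweedler]
    congr 1
    exact Subsingleton.elim _ _
  | succ m ih =>
    intro b F k
    simp only [psiAux, sweedler]
    refine Finset.sum_congr rfl fun i _ => ?_
    rw [mul_one, ← ih]
    congr 1
    funext ℓ
    congr 1
    funext t
    refine Fin.cases ?_ (fun t => ?_) t
    · simp
    · simp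

theorem SM_lin {N : H → ℕ} {Δ₁ Δ₂ : H → ℕ → H} (hrep : HRep N Δ₁ Δ₂)
    (ρ : H →ₗ[ℂ] A →ₗ[ℂ] A) (p : ℕ) :
    ∀ (b : Fin (p+1) → A), ∃ L : MultilinearMap ℂ (fun _ : Fin (p+1) => A) ℂ →ₗ[ℂ] H →ₗ[ℂ] ℂ,
     ∀ f w, sweedler N Δ₁ Δ₂ p w (fun ℓ => f (fun j => ρ (ℓ j) (b j))) = L f w := by
  induction p with
  | zero =>
    intro b
    refine ⟨LinearMap.mk₂ ℂ (fun f w => f.curryLeft (ρ w (b 0)) ![])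
      (by intros; simp) (by intros; simp) (by intros; simp) (by intros; simp), fun f w => ?_⟩
    simp only [sweedler, LinearMap.mk₂_apply, MultilinearMap.curryLeft_apply]
    congr 1
    funext j
    obtain rfl : j = 0 := Fin.fin_one_eq_zero j
    simp
  | succ p ih =>
    intro b
    obtain ⟨L, hL⟩ := ih (fun j => b j.succ)
    refine ⟨LinearMap.mk₂ ℂ (fun f w => TensorProduct.lift
       (L ∘ₗ f.curryLeft ∘ₗ ρ.flip (b 0)) (Coalgebra.comul (R := ℂ) w)) ?_ ?_ ?_ ?_,
       fun f w => ?_⟩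
    · intro f f' w
      have e : ∀ a, (f + f').curryLeft a = f.curryLeft a + f'.curryLeft a := fun _ => rfl
      simp only [← EE_eq hrep]; simp [EE, Finset.sum_add_distrib, e]
    · intro c f w
      have e : ∀ a, (c • f).curryLeft a = c • f.curryLeft a := fun _ => rfl
      simp only [← EE_eq hrep]; simp [EE, Finset.mul_sum, e]
    · intros; simp
    · intros; simp
    · simp only [LinearMap.mk₂_apply, ← EE_eq hrep, LinearMap.comp_apply, ← hL, sweedler, EE]
      refine Finset.sum_congr rfl fun i _ => ?_
      congr 1
      funext ℓ
      rw [MultilinearMap.curryLeft_apply]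
      congr 1
      funext t
      refine Fin.cases ?_ (fun t => ?_) t <;> simp

theorem sw_peel {N : H → ℕ} {Δ₁ Δ₂ : H → ℕ → H} (hrep : HRep N Δ₁ Δ₂)
    (ρ : H →ₗ[ℂ] A →ₗ[ℂ] A) (p : ℕ) :
    ∀ (b : Fin (p+1) → A) (f : Coch H A (p+1)) (y : H),
      sweedler N Δ₁ Δ₂ (p+1) y
        (fun ℓ => f (ℓ (Fin.last (p+1))) (fun j => ρ (ℓ j.castSucc) (b j)))
      = EE N Δ₁ Δ₂ y (fun y' y'' => sweedler N Δ₁ Δ₂ p y'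
        (fun ℓ => f y'' (fun j => ρ (ℓ j) (b j)))) := by
  induction p with
  | zero =>
    intro b f y
    simp only [sweedler, EE]
    refine Finset.sum_congr rfl fun i _ => ?_
    congr 1
    funext j
    obtain rfl : j = 0 := Fin.fin_one_eq_zero j
    simp
  | succ p ih =>
    intro b f y
    obtain ⟨L, hL⟩ := SM_lin hrep ρ p (fun j => b j.succ)
    have key := EE_coassoc hrep (LinearMap.mk₂ ℂ
      (fun u w' => ((L.flip w') ∘ₗ (slot f (ρ u (b 0)))))
      (by intros; ext; simp) (by intros; ext; simp)
      (by intros; ext; simp) (by intros; ext; simp)) y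
    simp only [LinearMap.mk₂_apply, LinearMap.comp_apply, LinearMap.flip_apply, ← hL,
      slot_apply] at key
    have e : ∀ (u : H) (ℓ : Fin (p+1) → H), (fun j => ρ ((Fin.cons u ℓ : Fin (p+2) → H) j) (b j))
       = (Fin.cons (ρ u (b 0)) (fun j => ρ (ℓ j) (b j.succ)) : Fin (p+2) → A) := by
      intro u ℓ
      funext t
      refine Fin.cases ?_ (fun t => ?_) t <;> simp
    have e2 : ∀ (u : H) (ℓ : Fin (p+2) → H),
       (fun j : Fin (p+2) => ρ ((Fin.cons u ℓ : Fin (p+3) → H) j.castSucc) (b j))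
       = (Fin.cons (ρ u (b 0)) (fun j => ρ (ℓ j.castSucc) (b j.succ)) : Fin (p+2) → A) := by
      intro u ℓ
      funext t
      refine Fin.cases ?_ (fun t => ?_) t
      · simp
      · simp
    have e3 : ∀ (u : H) (ℓ : Fin (p+2) → H),
       (Fin.cons u ℓ : Fin (p+3) → H) (Fin.last (p+1+1)) = ℓ (Fin.last (p+1)) := by
      intro u ℓ
      rw [← Fin.succ_last, Fin.cons_succ]
    refine Eq.trans ?_ (key.trans ?_)
    · rw [sweedler, EE]
      refine Finset.sum_congr rfl fun i _ => ?_
      simp only [e2, e3]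
      exact ih (fun j => b j.succ) (slot f (ρ (Δ₁ y i) (b 0))) (Δ₂ y i)
    · congr 1
      funext u w
      rw [sweedler, EE]
      simp only [e]

theorem claim {N : H → ℕ} {Δ₁ Δ₂ : H → ℕ → H} (hrep : HRep N Δ₁ Δ₂)
    (ρ : H →ₗ[ℂ] A →ₗ[ℂ] A) (hρ_one : ρ 1 = LinearMap.id)
    (hρ_mul : ∀ g h : H, ρ (g * h) = ρ g ∘ₗ ρ h)
    {Sinv : H →ₗ[ℂ] H} (hS : SI Sinv) {n : ℕ} (φ : Coch H A (n+1))
    (hφ : IsEquivariant N Δ₁ Δ₂ ρ (fun h a => φ h a)) (G k : H) (a : A) (b : Fin n → A) :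
    sweedler N Δ₁ Δ₂ n k (fun ℓ => φ (ℓ (Fin.last n) * G)
      (Fin.cons a (fun j => ρ (ℓ j.castSucc) (b j))))
    = EE N Δ₁ Δ₂ k (fun k1 k2 => φ (G * k2) (Fin.cons (ρ (Sinv k1) a) b)) := by
  have star : ∀ (k : H) (a' : A), φ (G * k) (Fin.cons a' b) =
      EE N Δ₁ Δ₂ k (fun k1 y => sweedler N Δ₁ Δ₂ n y (fun ℓ => φ (ℓ (Fin.last n) * G)
      (Fin.cons (ρ k1 a') (fun j => ρ (ℓ j.castSucc) (b j))))) := by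
    intro k a'
    have h1 := sw_peel hrep ρ n (Fin.cons a' b) (φ ∘ₗ LinearMap.mulRight ℂ G) k
    simp only [LinearMap.comp_apply, LinearMap.mulRight_apply] at h1
    have h2 : ∀ y' y'' : H, sweedler N Δ₁ Δ₂ n y' (fun ℓ => φ (y'' * G)
        (fun j => ρ (ℓ j) ((Fin.cons a' b : Fin (n+1) → A) j))) =
        EE N Δ₁ Δ₂ y' (fun p q =>
          φ (HopfAlgebra.antipode (R := ℂ) q * y'' * G * p) (Fin.cons a' b)) := by
      intro y' y''
      rw [← hφ y' (y'' * G) (Fin.cons a' b)]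
      simp [sweedler, EE, mul_assoc]
    simp only [h2] at h1
    have h3 := K3 hrep (LinearMap.mk₂ ℂ (fun p q => φ (q * G * p) (Fin.cons a' b))
      (by intros; simp [mul_add]) (by intros; simp) (by intros; simp [add_mul])
      (by intros; simp)) k
    simp only [LinearMap.mk₂_apply, one_mul] at h3
    rw [← h3, ← h1, sweedler, EE]
    refine Finset.sum_congr rfl fun i _ => ?_
    congr 1
    funext ℓ
    rw [← Fin.succ_last, Fin.cons_succ]
    congr 1
    funext t
    refine Fin.cases ?_ (fun t => ?_) t
    · simp
    · simp
  simp only [star]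
  have hf := fun (a : A) (k : H) => sw_eq_psi (N := N) (Δ₁ := Δ₁) (Δ₂ := Δ₂) ρ n b
    (fun h v => φ (h * G) (Fin.cons a v)) k
  simp only [hf]
  obtain ⟨B, hB⟩ := psi_bil hrep ρ (fun j => (b j, (1 : H)))
    (slot (φ ∘ₗ LinearMap.mulRight ℂ G) ∘ₗ ρ.flip a) 1
  simp only [mul_one, LinearMap.comp_apply, slot_apply, LinearMap.mulRight_apply,
    LinearMap.flip_apply] at hB
  have h := K2 hrep hS B k
  simp only [← hB, hρ_one, hρ_mul, LinearMap.comp_apply, LinearMap.id_apply] at h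
  exact h.symm

theorem psi_peel {N : H → ℕ} {Δ₁ Δ₂ : H → ℕ → H}
    (ρ : H →ₗ[ℂ] A →ₗ[ℂ] A) (m : ℕ) :
    ∀ (g : H) (x : Fin (m+1) → A × H) (F : H → (Fin (m+1) → A) → ℂ),
    psiAux N Δ₁ Δ₂ ρ (m+1) g x F = psiAux N Δ₁ Δ₂ ρ m g (fun j => x j.castSucc)
      (fun h v => EE N Δ₁ Δ₂ h (fun u w =>
        F (w * (x (Fin.last m)).2) (Fin.snoc v (ρ u (x (Fin.last m)).1)))) := by
  induction m with
  | zero =>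
    intro g x F
    simp only [psiAux, EE]
    refine Finset.sum_congr rfl fun i _ => ?_
    congr 1
    funext j
    obtain rfl : j = 0 := Fin.fin_one_eq_zero j
    rfl
  | succ m ih =>
    intro g x F
    rw [psiAux, psiAux]
    refine Finset.sum_congr rfl fun i _ => ?_
    rw [ih]
    simp only [Fin.succ_last, Fin.cons_snoc_eq_snoc_cons, Fin.succ_castSucc, Fin.castSucc_zero]

theorem psiAux_EE {N : H → ℕ} {Δ₁ Δ₂ : H → ℕ → H} {ρ : H →ₗ[ℂ] A →ₗ[ℂ] A} {m : ℕ} (g k : H)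
    (x : Fin m → A × H) (F : H → H → H → (Fin m → A) → ℂ) :
    psiAux N Δ₁ Δ₂ ρ m g x (fun h v => EE N Δ₁ Δ₂ k (fun p q => F p q h v)) =
    EE N Δ₁ Δ₂ k (fun p q => psiAux N Δ₁ Δ₂ ρ m g x (fun h v => F p q h v)) := by
  obtain ⟨ι, _, G, b, h⟩ := psiAux_rep N Δ₁ Δ₂ ρ m g x
  simp only [h, EE]
  exact Finset.sum_comm

theorem psiAux_sw {N : H → ℕ} {Δ₁ Δ₂ : H → ℕ → H} {ρ : H →ₗ[ℂ] A →ₗ[ℂ] A} {m r : ℕ} (g k : H)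
    (x : Fin m → A × H) (F : (Fin (r+1) → H) → H → (Fin m → A) → ℂ) :
    sweedler N Δ₁ Δ₂ r k (fun l => psiAux N Δ₁ Δ₂ ρ m g x (fun h v => F l h v)) =
    psiAux N Δ₁ Δ₂ ρ m g x (fun h v => sweedler N Δ₁ Δ₂ r k (fun l => F l h v)) := by
  obtain ⟨ι, _, G, b, h⟩ := psiAux_rep N Δ₁ Δ₂ ρ m g x
  simp only [h]
  exact sweedler_sum k _ _

theorem psi_unit {N : H → ℕ} {Δ₁ Δ₂ : H → ℕ → H} (hrep : HRep N Δ₁ Δ₂)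
    (ρ : H →ₗ[ℂ] A →ₗ[ℂ] A) (hρ_one : ρ 1 = LinearMap.id) {m : ℕ}
    (x : Fin (m+1) → A × H) (f : Coch H A (m+1)) :
    psiAux N Δ₁ Δ₂ ρ (m+1) 1 x (fun h v => f h v) =
    psiAux N Δ₁ Δ₂ ρ m (x 0).2 (fun j => x j.succ) (fun h v => f h (Fin.cons (x 0).1 v)) := by
  obtain ⟨B, hB⟩ := psi_bil hrep ρ (fun j => x j.succ) (slot f ∘ₗ ρ.flip (x 0).1) (x 0).2
  have h1 := EE_one hrep B
  simp only [← hB] at h1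
  refine Eq.trans ?_ (h1.trans ?_)
  · rfl
  · simp [hρ_one, slot_apply]

/-- `Ψ` commutes with the cyclic operators: `Ψ(tφ) = τ(Ψφ)`,
evaluated on elementary tensors, where
`tφ(h, a⁰,…,aⁿ) = φ(h₍₂₎, S⁻¹(h₍₁₎)(aⁿ), a⁰, …, aⁿ⁻¹)` and
`τψ(x⁰,…,xⁿ) = ψ(xⁿ, x⁰, …, xⁿ⁻¹)`. -/
theorem statement8 {n : ℕ}
    (N : H → ℕ) (Δ₁ Δ₂ : H → ℕ → H)
    (hrep : ∀ g : H, (Coalgebra.comul (R := ℂ) g : H ⊗[ℂ] H) =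
      ∑ i ∈ Finset.range (N g), Δ₁ g i ⊗ₜ[ℂ] Δ₂ g i)
    (ρ : H →ₗ[ℂ] A →ₗ[ℂ] A)
    (hρ_one : ρ 1 = LinearMap.id)
    (hρ_mul : ∀ g h : H, ρ (g * h) = ρ g ∘ₗ ρ h)
    (hact_mul : ∀ (h : H) (a b : A),
      ρ h (a * b) = ∑ i ∈ Finset.range (N h), ρ (Δ₁ h i) a * ρ (Δ₂ h i) b)
    (hact_one : ∀ h : H, ρ h 1 = (Coalgebra.counit (R := ℂ) h) • (1 : A))
    (Sinv : H →ₗ[ℂ] H)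
    (hSinv : ∀ h : H, Sinv (HopfAlgebra.antipode (R := ℂ) h) = h ∧
      HopfAlgebra.antipode (R := ℂ) (Sinv h) = h)
    (φ : H →ₗ[ℂ] MultilinearMap ℂ (fun _ : Fin (n+1) => A) ℂ)
    (hφ : IsEquivariant N Δ₁ Δ₂ ρ (fun h a => φ h a)) :
    ∀ x : Fin (n+1) → A × H,
      psiV N Δ₁ Δ₂ ρ (cycOpEq N Δ₁ Δ₂ ρ Sinv (fun h a => φ h a)) x
        = psiV N Δ₁ Δ₂ ρ (fun h a => φ h a) (fun i => x (i - 1)) := by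
  replace hrep : HRep N Δ₁ Δ₂ := hrep
  replace hSinv : SI Sinv := hSinv
  intro x
  have hx0 : (0 : Fin (n+1)) - 1 = Fin.last n := by
    rw [sub_eq_iff_eq_add]; simp
  have hxs : ∀ j : Fin n, j.succ - 1 = j.castSucc := by
    intro j
    rw [sub_eq_iff_eq_add]; simp
  have hR : psiV N Δ₁ Δ₂ ρ (fun h a => φ h a) (fun i => x (i - 1)) =
      EE N Δ₁ Δ₂ (x (Fin.last n)).2 (fun k1 k2 => psiAux N Δ₁ Δ₂ ρ n 1 (fun j => x j.castSucc)
        (fun h v => φ (h * k2) (Fin.cons (ρ (Sinv k1) (x (Fin.last n)).1) v))) := by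
    simp only [psiV, hx0, hxs]
    have h := psi_R hrep ρ hρ_mul n (fun j => x j.castSucc) (slot φ (x (Fin.last n)).1)
      (x (Fin.last n)).2 1
    simp only [mul_one, slot_apply] at h
    rw [h, ← psiAux_EE, psiAux_sw]
    congr 1
    funext h v
    exact claim hrep ρ hρ_one hρ_mul hSinv φ hφ h _ _ v
  rw [hR]
  have hc : ∀ {n : ℕ} (φ : Coch H A (n+1)) (h : H) (a : Fin (n+1) → A),
      cycOpEq N Δ₁ Δ₂ ρ Sinv (fun h a => φ h a) h a =
      EE N Δ₁ Δ₂ h (fun p q => φ q (Fin.cons (ρ (Sinv p) (a (Fin.last n)))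
        (fun j : Fin n => a j.castSucc))) := fun φ h a => rfl
  rcases n with _ | m
  · simp only [psiV, psiAux, hc, one_mul]
    congr 1
    funext p q
    congr 1
    funext j
    obtain rfl : j = 0 := Fin.fin_one_eq_zero j
    rfl
  · have hu := fun k1 k2 => psi_unit hrep ρ hρ_one (fun j => x j.castSucc)
      (slot (φ ∘ₗ LinearMap.mulRight ℂ k2) (ρ (Sinv k1) (x (Fin.last (m+1))).1))
    simp only [slot_apply, LinearMap.comp_apply, LinearMap.mulRight_apply] at hu
    simp only [hu]
    rw [← psiAux_EE, psiV, psi_peel]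
    have hz : (0 : Fin (m+1)).castSucc = 0 := rfl
    simp only [hz, Fin.succ_last, Fin.succ_castSucc]
    congr 1
    funext G b
    simp only [hc]
    have e1 : ∀ c : A, (Fin.cons (x 0).1 (Fin.snoc b c : Fin (m+1) → A) : Fin (m+2) → A)
        (Fin.last (m+1)) = c := by
      intro c
      rw [Fin.cons_snoc_eq_snoc_cons, Fin.snoc_last]
    have e2 : ∀ c : A, (fun j : Fin (m+1) =>
        (Fin.cons (x 0).1 (Fin.snoc b c : Fin (m+1) → A) : Fin (m+2) → A) j.castSucc)
         = (Fin.cons (x 0).1 b : Fin (m+1) → A) := by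
      intro c
      funext j
      rw [Fin.cons_snoc_eq_snoc_cons, Fin.snoc_castSucc]
    simp only [e1, e2]
    set a := (x (Fin.last (m+1))).1
    set k := (x (Fin.last (m+1))).2
    have s1 : ∀ u w : H, EE N Δ₁ Δ₂ (w * k) (fun p q =>
        φ q (Fin.cons (ρ (Sinv p) (ρ u a)) (Fin.cons (x 0).1 b))) =
        EE N Δ₁ Δ₂ w (fun w1 w2 => EE N Δ₁ Δ₂ k (fun k1 k2 =>
          φ (w2 * k2) (Fin.cons (ρ (Sinv k1) (ρ (Sinv w1 * u) a)) (Fin.cons (x 0).1 b)))) := by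
      intro u w
      have := EE_mul hrep (LinearMap.mk₂ ℂ (fun p q =>
        slot φ (ρ (Sinv p) (ρ u a)) q (Fin.cons (x 0).1 b))
        (by intros; simp) (by intros; simp) (by intros; simp) (by intros; simp)) w k
      simp only [LinearMap.mk₂_apply, slot_apply, Sinv_mul hSinv, hρ_mul,
        LinearMap.comp_apply] at this
      simpa only [hρ_mul, LinearMap.comp_apply] using this
    simp only [s1]
    have s2 : ∀ u w : H, EE N Δ₁ Δ₂ w (fun w1 w2 => EE N Δ₁ Δ₂ k (fun k1 k2 =>
          φ (w2 * k2) (Fin.cons (ρ (Sinv k1) (ρ (Sinv w1 * u) a)) (Fin.cons (x 0).1 b)))) =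
        EE N Δ₁ Δ₂ k (fun k1 k2 => EE N Δ₁ Δ₂ w (fun w1 w2 =>
          φ (w2 * k2) (Fin.cons (ρ (Sinv k1) (ρ (Sinv w1 * u) a)) (Fin.cons (x 0).1 b)))) :=
      fun u w => EE_comm _ _ _
    simp only [s2]
    rw [EE_comm]
    congr 1
    funext k1 k2
    have s3 := K1 hrep hSinv (LinearMap.mk₂ ℂ (fun z q =>
        slot φ (ρ (Sinv k1) (ρ z a)) (q * k2) (Fin.cons (x 0).1 b))
        (by intros; simp) (by intros; simp) (by intros; simp [add_mul]) (by intros; simp)) G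
    simp only [LinearMap.mk₂_apply, slot_apply, hρ_one, LinearMap.id_apply] at s3
    exact s3

end
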